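/- The double sum ∑_{k=1}^{d+e−2} ∑_{i=0}^{k+1} (−1)^k · i · C(d−1, k+1−i) · z^{k+1−i} · C(e,i) · z^{ei} equals e z^e [ (1−z)^{d−1} (1−z^e)^{e−1} − 1 ], as polynomials in z. -/

import Mathlib

open Polynomial

lemma aux_coeff {R : Type*} [CommRing R] (y : R) (n k : ℕ) :
    ((1 + C y * X : R[X]) ^ n).coeff k = (n.choose k : R) * y ^ k := by
  have h : (1 + C y * X : R[X]) ^ n = ((1 + X : R[X]) ^ n).comp (C y * X) := by simp
  rw [h, comp_C_mul_X_coeff, coeff_one_add_X_pow]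

lemma aux_deg {R : Type*} [CommRing R] (y : R) (n : ℕ) :
    ((1 + C y * X : R[X]) ^ n).natDegree ≤ n := by
  have h : (1 + C y * X : R[X]).natDegree ≤ 1 := by compute_degree
  simpa using natDegree_pow_le_of_le n h

lemma aux_sum {R : Type*} [CommRing R] (y w : R) (a b : ℕ) :
    ∑ k ∈ Finset.range (a + b + 1), ∑ m ∈ Finset.range (k + 1),
      ((b.choose m : R) * y ^ m) * ((a.choose (k - m) : R) * w ^ (k - m)) =
      (1 + y) ^ b * (1 + w) ^ a := by
  have h1 : ((1 + C y * X : R[X]) ^ b * (1 + C w * X : R[X]) ^ a).natDegree < a + b + 1 := by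
    have := natDegree_mul_le_of_le (aux_deg y b) (aux_deg w a)
    omega
  have h2 := eval_eq_sum_range' h1 1
  simp only [one_pow, mul_one, coeff_mul, aux_coeff,
    Finset.Nat.sum_antidiagonal_eq_sum_range_succ_mk] at h2
  rw [← h2]
  simp

/-- `∑_{k=1}^{d+e−2} ∑_{i=0}^{k+1} (−1)^k i C(d−1,k+1−i) z^{k+1−i} C(e,i) z^{ei}
      = e z^e [(1−z)^{d−1}(1−z^e)^{e−1} − 1]` in `ℤ[z]`. -/
theorem stmt4 (d e : ℕ) (hd : 1 ≤ d) (he : 1 ≤ e) :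
    (∑ k ∈ Finset.Icc 1 (d + e - 2), ∑ i ∈ Finset.range (k + 2),
        C ((-1) ^ k * (i : ℤ) * (((d - 1).choose (k + 1 - i) : ℕ) : ℤ) *
            ((e.choose i : ℕ) : ℤ)) * X ^ (k + 1 - i) * X ^ (e * i)) =
      C ((e : ℕ) : ℤ) * X ^ e * ((1 - X) ^ (d - 1) * (1 - X ^ e) ^ (e - 1) - 1) := by
  obtain ⟨a, rfl⟩ := Nat.exists_eq_add_of_le' hd
  obtain ⟨b, rfl⟩ := Nat.exists_eq_add_of_le' he
  have key := aux_sum (-(X : ℤ[X]) ^ (b + 1)) (-X) a b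
  rw [Finset.sum_range_succ'] at key
  have hI : Finset.Icc 1 (a + 1 + (b + 1) - 2) = Finset.Ico (0 + 1) (a + b + 1) := by
    ext; simp; omega
  rw [hI, ← Finset.sum_Ico_add' _ 0 (a + b) 1, ← Finset.range_eq_Ico]
  have hin : ∀ k ∈ Finset.range (a + b), ∑ i ∈ Finset.range (k + 1 + 2),
        C ((-1) ^ (k + 1) * (i : ℤ) * (((a + 1 - 1).choose (k + 1 + 1 - i) : ℕ) : ℤ) *
            (((b + 1).choose i : ℕ) : ℤ)) * X ^ (k + 1 + 1 - i) * X ^ ((b + 1) * i) =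
      C (((b + 1 : ℕ) : ℤ)) * X ^ (b + 1) * ∑ m ∈ Finset.range (k + 1 + 1),
      ((b.choose m : ℤ[X]) * (-(X : ℤ[X]) ^ (b + 1)) ^ m) *
        ((a.choose (k + 1 - m) : ℤ[X]) * (-X) ^ (k + 1 - m)) := by
    intro k _
    rw [Finset.sum_range_succ', Finset.mul_sum]
    simp only [Nat.cast_zero, mul_zero, zero_mul, map_zero, add_zero]
    refine Finset.sum_congr rfl fun m hm => ?_
    have hm' : m ≤ k + 1 := by simp at hm; omega
    obtain ⟨j, hj⟩ := Nat.exists_eq_add_of_le hm'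
    have e1 : k + 1 + 1 - (m + 1) = j := by omega
    have e2 : k + 1 - m = j := by omega
    have hc : ((b + 1 : ℕ) : ℤ[X]) * (b.choose m : ℤ[X]) =
        ((b + 1).choose (m + 1) : ℤ[X]) * ((m + 1 : ℕ) : ℤ[X]) := by
      exact_mod_cast congrArg (Nat.cast (R := ℤ[X])) (Nat.add_one_mul_choose_eq b m)
    rw [e1, e2, hj, neg_pow ((X : ℤ[X]) ^ (b + 1)), neg_pow (X : ℤ[X]) j]
    simp only [map_mul, map_pow, map_neg, map_one, map_natCast, Nat.add_sub_cancel]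
    linear_combination (-(-1) ^ (m + j) * (a.choose j : ℤ[X]) * X ^ j * X ^ ((b + 1) * (m + 1))) * hc
  rw [Finset.sum_congr rfl hin, ← Finset.mul_sum, eq_sub_of_add_eq key]
  simp only [zero_add, Finset.sum_range_one, Nat.choose_zero_right, Nat.cast_one, pow_zero, mul_one,
    Nat.sub_self, Nat.add_sub_cancel]
  ring
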